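/- arXiv:1411.3841 — 5 statements merged into one kernel-verified Lean document; each statement's English description precedes it below -/
import Mathlib

section
/- Let n₁, n₂, n₃, n₄, k₁, k₂ be six pairwise-distinct positive integers. Then the 4×4 real matrix whose j-th row (j = 1,2,3,4) is ( 1/n_j², 1/n_j, 1/(n_j − k₁) + 1/(n_j + k₁), 1/(n_j − k₂) + 1/(n_j + k₂) ) has nonzero determinant, i.e., it is full rank (invertible). -/
open Matrix

theorem aux_det (a b c d : Fin 4 → ℝ) :
    (Matrix.of ![![a 0, b 0, c 0, d 0], ![a 1, b 1, c 1, d 1], ![a 2, b 2, c 2, d 2],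
      ![a 3, b 3, c 3, d 3]]).det =
      (a 0 * b 1 - a 1 * b 0) * (c 2 * d 3 - c 3 * d 2)
      - (a 0 * b 2 - a 2 * b 0) * (c 1 * d 3 - c 3 * d 1)
      + (a 0 * b 3 - a 3 * b 0) * (c 1 * d 2 - c 2 * d 1)
      + (a 1 * b 2 - a 2 * b 1) * (c 0 * d 3 - c 3 * d 0)
      - (a 1 * b 3 - a 3 * b 1) * (c 0 * d 2 - c 2 * d 0)
      + (a 2 * b 3 - a 3 * b 2) * (c 0 * d 1 - c 1 * d 0) := by
  simp [Matrix.det_succ_row_zero, Fin.sum_univ_succ, Fin.succAbove]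
  ring

theorem aux_ent (x k l : ℝ) (hx : x ≠ 0) (h1 : x - k ≠ 0) (h2 : x + k ≠ 0)
    (h3 : x - l ≠ 0) (h4 : x + l ≠ 0) :
    ∃ r : ℝ, r ≠ 0 ∧ 1 / x ^ 2 = r * ((x^2-k^2)*(x^2-l^2)) ∧
      1 / x = r * (x * ((x^2-k^2)*(x^2-l^2))) ∧
      1 / (x - k) + 1 / (x + k) = r * (2 * x^3 * (x^2-l^2)) ∧
      1 / (x - l) + 1 / (x + l) = r * (2 * x^3 * (x^2-k^2)) := by
  have e1 : x^2-k^2 = (x-k)*(x+k) := by ring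
  have e2 : x^2-l^2 = (x-l)*(x+l) := by ring
  rw [e1, e2]
  refine ⟨1 / (x^2 * (((x-k)*(x+k))*((x-l)*(x+l)))), by positivity, ?_, ?_, ?_, ?_⟩
  · field_simp
  · field_simp
  · field_simp
    ring
  · field_simp
    ring

theorem aux_id (x y z w A B : ℝ) (a b c d : Fin 4 → ℝ) (r s t u : ℝ)
    (ha : a = ![r * ((x^2-A)*(x^2-B)), s * ((y^2-A)*(y^2-B)), t * ((z^2-A)*(z^2-B)), u * ((w^2-A)*(w^2-B))])
    (hb : b = ![r * (x*((x^2-A)*(x^2-B))), s * (y*((y^2-A)*(y^2-B))), t * (z*((z^2-A)*(z^2-B))), u * (w*((w^2-A)*(w^2-B)))])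
    (hc : c = ![r * (2*x^3*(x^2-B)), s * (2*y^3*(y^2-B)), t * (2*z^3*(z^2-B)), u * (2*w^3*(w^2-B))])
    (hd : d = ![r * (2*x^3*(x^2-A)), s * (2*y^3*(y^2-A)), t * (2*z^3*(z^2-A)), u * (2*w^3*(w^2-A))]) :
    (a 0 * b 1 - a 1 * b 0) * (c 2 * d 3 - c 3 * d 2)
      - (a 0 * b 2 - a 2 * b 0) * (c 1 * d 3 - c 3 * d 1)
      + (a 0 * b 3 - a 3 * b 0) * (c 1 * d 2 - c 2 * d 1)
      + (a 1 * b 2 - a 2 * b 1) * (c 0 * d 3 - c 3 * d 0)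
      - (a 1 * b 3 - a 3 * b 1) * (c 0 * d 2 - c 2 * d 0)
      + (a 2 * b 3 - a 3 * b 2) * (c 0 * d 1 - c 1 * d 0) =
    r*s*t*u * (4 * (A*B) * (A-B) * ((y-x)*(z-x)*(w-x)*(z-y)*(w-y)*(w-z)) *
     (A*B*(x^2*(y+z+w) + y^2*(x+z+w) + z^2*(x+y+w) + w^2*(x+y+z)
        + 2*(x*y*z+x*y*w+x*z*w+y*z*w))
      + (A+B)*(x*y*z*w)*(x+y+z+w) + (x*y*z*w)*(x*y*z+x*y*w+x*z*w+y*z*w))) := by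
  subst ha hb hc hd
  simp only [Matrix.cons_val]
  ring

/-- Lemma 3: for six pairwise-distinct positive integers `n₁, n₂, n₃, n₄, k₁, k₂`,
the 4×4 matrix with rows `(1/n_j², 1/n_j, 1/(n_j−k₁)+1/(n_j+k₁), 1/(n_j−k₂)+1/(n_j+k₂))`
has nonzero determinant, i.e. it is invertible (full rank). -/
theorem matrix_full_rank
    (n₁ n₂ n₃ n₄ k₁ k₂ : ℕ)
    (hpos : 0 < n₁ ∧ 0 < n₂ ∧ 0 < n₃ ∧ 0 < n₄ ∧ 0 < k₁ ∧ 0 < k₂)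
    (hdist : [n₁, n₂, n₃, n₄, k₁, k₂].Pairwise (· ≠ ·)) :
    (Matrix.of
      ![![1 / (n₁ : ℝ) ^ 2, 1 / (n₁ : ℝ),
          1 / ((n₁ : ℝ) - (k₁ : ℝ)) + 1 / ((n₁ : ℝ) + (k₁ : ℝ)),
          1 / ((n₁ : ℝ) - (k₂ : ℝ)) + 1 / ((n₁ : ℝ) + (k₂ : ℝ))],
        ![1 / (n₂ : ℝ) ^ 2, 1 / (n₂ : ℝ),
          1 / ((n₂ : ℝ) - (k₁ : ℝ)) + 1 / ((n₂ : ℝ) + (k₁ : ℝ)),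
          1 / ((n₂ : ℝ) - (k₂ : ℝ)) + 1 / ((n₂ : ℝ) + (k₂ : ℝ))],
        ![1 / (n₃ : ℝ) ^ 2, 1 / (n₃ : ℝ),
          1 / ((n₃ : ℝ) - (k₁ : ℝ)) + 1 / ((n₃ : ℝ) + (k₁ : ℝ)),
          1 / ((n₃ : ℝ) - (k₂ : ℝ)) + 1 / ((n₃ : ℝ) + (k₂ : ℝ))],
        ![1 / (n₄ : ℝ) ^ 2, 1 / (n₄ : ℝ),
          1 / ((n₄ : ℝ) - (k₁ : ℝ)) + 1 / ((n₄ : ℝ) + (k₁ : ℝ)),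
          1 / ((n₄ : ℝ) - (k₂ : ℝ)) + 1 / ((n₄ : ℝ) + (k₂ : ℝ))]]).det ≠ 0 := by
  obtain ⟨p1, p2, p3, p4, p5, p6⟩ := hpos
  simp only [List.pairwise_cons, List.mem_cons, List.not_mem_nil, or_false, forall_eq_or_imp,
    forall_eq, ne_eq] at hdist
  obtain ⟨⟨h12, h13, h14, h1k, h1l⟩, ⟨h23, h24, h2k, h2l⟩, ⟨h34, h3k, h3l⟩, ⟨h4k, h4l⟩, hkl, -⟩ := hdist
  have sub : ∀ {m n : ℕ}, ¬ m = n → (m : ℝ) - n ≠ 0 := fun h =>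
    sub_ne_zero.mpr (by exact_mod_cast h)
  have sub' : ∀ {m n : ℕ}, ¬ m = n → (n : ℝ) - m ≠ 0 := fun h => sub (Ne.symm h)
  have ps : ∀ {m n : ℕ}, 0 < m → (m : ℝ) + n ≠ 0 := fun h => by positivity
  have pz : ∀ {m : ℕ}, 0 < m → (m : ℝ) ≠ 0 := fun h => by positivity
  obtain ⟨r1, q1, a1, b1, c1, d1⟩ := aux_ent n₁ k₁ k₂ (pz p1) (sub h1k) (ps p1) (sub h1l) (ps p1)
  obtain ⟨r2, q2, a2, b2, c2, d2⟩ := aux_ent n₂ k₁ k₂ (pz p2) (sub h2k) (ps p2) (sub h2l) (ps p2)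
  obtain ⟨r3, q3, a3, b3, c3, d3⟩ := aux_ent n₃ k₁ k₂ (pz p3) (sub h3k) (ps p3) (sub h3l) (ps p3)
  obtain ⟨r4, q4, a4, b4, c4, d4⟩ := aux_ent n₄ k₁ k₂ (pz p4) (sub h4k) (ps p4) (sub h4l) (ps p4)
  rw [a1, b1, c1, d1, a2, b2, c2, d2, a3, b3, c3, d3, a4, b4, c4, d4]
  have key := aux_det
    (![r1 * (((n₁:ℝ)^2-((k₁:ℝ)^2))*((n₁:ℝ)^2-((k₂:ℝ)^2))), r2 * (((n₂:ℝ)^2-((k₁:ℝ)^2))*((n₂:ℝ)^2-((k₂:ℝ)^2))), r3 * (((n₃:ℝ)^2-((k₁:ℝ)^2))*((n₃:ℝ)^2-((k₂:ℝ)^2))), r4 * (((n₄:ℝ)^2-((k₁:ℝ)^2))*((n₄:ℝ)^2-((k₂:ℝ)^2)))])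
    (![r1 * ((n₁:ℝ)*(((n₁:ℝ)^2-((k₁:ℝ)^2))*((n₁:ℝ)^2-((k₂:ℝ)^2)))), r2 * ((n₂:ℝ)*(((n₂:ℝ)^2-((k₁:ℝ)^2))*((n₂:ℝ)^2-((k₂:ℝ)^2)))), r3 * ((n₃:ℝ)*(((n₃:ℝ)^2-((k₁:ℝ)^2))*((n₃:ℝ)^2-((k₂:ℝ)^2)))), r4 * ((n₄:ℝ)*(((n₄:ℝ)^2-((k₁:ℝ)^2))*((n₄:ℝ)^2-((k₂:ℝ)^2))))])
    (![r1 * (2*(n₁:ℝ)^3*((n₁:ℝ)^2-((k₂:ℝ)^2))), r2 * (2*(n₂:ℝ)^3*((n₂:ℝ)^2-((k₂:ℝ)^2))), r3 * (2*(n₃:ℝ)^3*((n₃:ℝ)^2-((k₂:ℝ)^2))), r4 * (2*(n₄:ℝ)^3*((n₄:ℝ)^2-((k₂:ℝ)^2)))])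
    (![r1 * (2*(n₁:ℝ)^3*((n₁:ℝ)^2-((k₁:ℝ)^2))), r2 * (2*(n₂:ℝ)^3*((n₂:ℝ)^2-((k₁:ℝ)^2))), r3 * (2*(n₃:ℝ)^3*((n₃:ℝ)^2-((k₁:ℝ)^2))), r4 * (2*(n₄:ℝ)^3*((n₄:ℝ)^2-((k₁:ℝ)^2)))])
  rw [aux_id n₁ n₂ n₃ n₄ ((k₁:ℝ)^2) ((k₂:ℝ)^2) _ _ _ _ r1 r2 r3 r4 rfl rfl rfl rfl] at key
  simp only [Matrix.cons_val] at key
  rw [key]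
  have hAB : (k₁ : ℝ)^2 - (k₂ : ℝ)^2 ≠ 0 := by
    rw [show (k₁ : ℝ)^2 - (k₂ : ℝ)^2 = ((k₁ : ℝ) - k₂) * (k₁ + k₂) by ring]
    exact mul_ne_zero (sub hkl) (ps p5)
  refine mul_ne_zero (by simp [q1, q2, q3, q4]) (mul_ne_zero (mul_ne_zero (mul_ne_zero (by positivity) hAB) ?_) (by positivity))
  simp [sub' h12, sub' h13, sub' h14, sub' h23, sub' h24, sub' h34]
end

section
/- Let n₁, n₂, n₃, n₄, k₁, k₂ be six pairwise-distinct positive integers. Then the linear map from ℂ⁴ to ℂ⁴ sending (R, I, U, W) to the quadruple whose j-th component (j = 1,2,3,4) is R/n_j² + i·I/n_j + 2U·( 1/(n_j − k₁) + 1/(n_j + k₁) ) + 2W·( 1/(n_j − k₂) + 1/(n_j + k₂) ) is bijective; in particular, (R, I, U, W) are uniquely determined by the four values c_{n₁}, c_{n₂}, c_{n₃}, c_{n₄} of this map. -/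
open Complex

lemma aux_eq (n k l : ℕ) (hn : 0 < n) (hk : n ≠ k) (hl : n ≠ l) (R I U W : ℂ)
    (h : R / (n : ℂ) ^ 2 + Complex.I * I / (n : ℂ) +
          2 * U * (1 / ((n : ℂ) - (k : ℂ)) + 1 / ((n : ℂ) + (k : ℂ))) +
          2 * W * (1 / ((n : ℂ) - (l : ℂ)) + 1 / ((n : ℂ) + (l : ℂ))) = 0) :
    R * ((n : ℂ) ^ 4 - ((k : ℂ) ^ 2 + (l : ℂ) ^ 2) * (n : ℂ) ^ 2 + (k : ℂ) ^ 2 * (l : ℂ) ^ 2)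
     + n * (Complex.I * I * (k : ℂ) ^ 2 * (l : ℂ) ^ 2
      + (-(Complex.I * I) * ((k : ℂ) ^ 2 + (l : ℂ) ^ 2) - 4 * U * (l : ℂ) ^ 2
          - 4 * W * (k : ℂ) ^ 2) * (n : ℂ) ^ 2
      + (Complex.I * I + 4 * U + 4 * W) * ((n : ℂ) ^ 2) ^ 2) = 0 := by
  have h0 : (n : ℂ) ≠ 0 := by exact_mod_cast hn.ne'
  have h1 : (n : ℂ) - k ≠ 0 := sub_ne_zero.2 (by exact_mod_cast hk)
  have h2 : (n : ℂ) - l ≠ 0 := sub_ne_zero.2 (by exact_mod_cast hl)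
  have h3 : (n : ℂ) + k ≠ 0 := by exact_mod_cast (by omega : n + k ≠ 0)
  have h4 : (n : ℂ) + l ≠ 0 := by exact_mod_cast (by omega : n + l ≠ 0)
  generalize Complex.I * I = J at *
  field_simp at h
  linear_combination h

lemma aux_sq (n m : ℕ) (h : n ≠ m) : (n : ℂ) ^ 2 - (m : ℂ) ^ 2 ≠ 0 := by
  refine sub_ne_zero.2 ?_
  have : n ^ 2 ≠ m ^ 2 := fun e => h (Nat.pow_left_injective (n := 2) (by norm_num) e)
  exact_mod_cast this

lemma aux_R (a b c d k l : ℕ) (ha : 0 < a) (hb : 0 < b) (hc : 0 < c) (hd : 0 < d)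
    (hk : 0 < k) (hl : 0 < l)
    (hab : a ≠ b) (hac : a ≠ c) (had : a ≠ d) (hbc : b ≠ c) (hbd : b ≠ d) (hcd : c ≠ d)
    (R A B C : ℂ)
    (e : ∀ n : ℕ, n = a ∨ n = b ∨ n = c ∨ n = d →
      R * ((n : ℂ) ^ 4 - ((k : ℂ) ^ 2 + (l : ℂ) ^ 2) * (n : ℂ) ^ 2 + (k : ℂ) ^ 2 * (l : ℂ) ^ 2)
       + n * (A + B * (n : ℂ) ^ 2 + C * ((n : ℂ) ^ 2) ^ 2) = 0) :
    R = 0 ∧ A = 0 ∧ B = 0 ∧ C = 0 := by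
  have ea := e a (by simp)
  have eb := e b (by simp)
  have ec := e c (by simp)
  have ed := e d (by simp)
  have nz : ∀ {x : ℕ}, 0 < x → (x : ℂ) ≠ 0 := fun h => by exact_mod_cast h.ne'
  have sz : ∀ {x y : ℕ}, x ≠ y → (x : ℂ) - y ≠ 0 := fun h => sub_ne_zero.2 (by exact_mod_cast h)
  have hK : (((k ^ 2 * l ^ 2 * (a ^ 2 * (b + c + d) + b ^ 2 * (a + c + d) + c ^ 2 * (a + b + d)
      + d ^ 2 * (a + b + c) + 2 * (a * b * c + a * b * d + a * c * d + b * c * d))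
      + a * b * c * d * ((a * b * c + a * b * d + a * c * d + b * c * d)
        + (k ^ 2 + l ^ 2) * (a + b + c + d)) : ℕ)) : ℂ) ≠ 0 := nz (by positivity)
  push_cast at hK
  have hR : R = 0 := by
    have hV := mul_ne_zero (mul_ne_zero (mul_ne_zero (sz hab) (sz hac)) (mul_ne_zero (sz had) (sz hbc)))
      (mul_ne_zero (sz hbd) (sz hcd))
    refine (mul_eq_zero.1 (?_ : R * _ = 0)).resolve_right (mul_ne_zero hV hK)
    generalize (a : ℂ) = a at *
    generalize (b : ℂ) = b at *
    generalize (c : ℂ) = c at *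
    generalize (d : ℂ) = d at *
    generalize (k : ℂ) = k at *
    generalize (l : ℂ) = l at *
    linear_combination (-1) * (
      b * c * d * ((b^2-c^2)*(b^2-d^2)*(c^2-d^2)) * ea
      - a * c * d * ((a^2-c^2)*(a^2-d^2)*(c^2-d^2)) * eb
      + a * b * d * ((a^2-b^2)*(a^2-d^2)*(b^2-d^2)) * ec
      - a * b * c * ((a^2-b^2)*(a^2-c^2)*(b^2-c^2)) * ed)
  subst hR
  have fa : A + B * (a : ℂ) ^ 2 + C * ((a : ℂ) ^ 2) ^ 2 = 0 := by simpa [ha.ne'] using ea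
  have fb : A + B * (b : ℂ) ^ 2 + C * ((b : ℂ) ^ 2) ^ 2 = 0 := by simpa [hb.ne'] using eb
  have fc : A + B * (c : ℂ) ^ 2 + C * ((c : ℂ) ^ 2) ^ 2 = 0 := by simpa [hc.ne'] using ec
  have g1 : B + C * ((a : ℂ) ^ 2 + (b : ℂ) ^ 2) = 0 :=
    (mul_eq_zero.1 (by linear_combination fa - fb :
      ((a : ℂ) ^ 2 - (b : ℂ) ^ 2) * (B + C * ((a : ℂ) ^ 2 + (b : ℂ) ^ 2)) = 0)).resolve_left
      (aux_sq a b hab)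
  have g2 : B + C * ((a : ℂ) ^ 2 + (c : ℂ) ^ 2) = 0 :=
    (mul_eq_zero.1 (by linear_combination fa - fc :
      ((a : ℂ) ^ 2 - (c : ℂ) ^ 2) * (B + C * ((a : ℂ) ^ 2 + (c : ℂ) ^ 2)) = 0)).resolve_left
      (aux_sq a c hac)
  have hC : C = 0 :=
    (mul_eq_zero.1 (by linear_combination g1 - g2 :
      ((b : ℂ) ^ 2 - (c : ℂ) ^ 2) * C = 0)).resolve_left (aux_sq b c hbc)
  subst hC
  have hB : B = 0 := by simpa using g1
  subst hB
  exact ⟨rfl, by simpa using fa, rfl, rfl⟩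

/-- The linear system (15) evaluated at four indices `n₁, n₂, n₃, n₄` distinct from
`k₁, k₂` determines `(R, I, U, W)` uniquely: the map is bijective. -/
theorem linear_system_bijective
    (n₁ n₂ n₃ n₄ k₁ k₂ : ℕ)
    (hpos : 0 < n₁ ∧ 0 < n₂ ∧ 0 < n₃ ∧ 0 < n₄ ∧ 0 < k₁ ∧ 0 < k₂)
    (hdist : [n₁, n₂, n₃, n₄, k₁, k₂].Pairwise (· ≠ ·)) :
    Function.Bijective (fun RIUW : ℂ × ℂ × ℂ × ℂ =>
      ((RIUW.1 / (n₁ : ℂ) ^ 2 + Complex.I * RIUW.2.1 / (n₁ : ℂ) +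
          2 * RIUW.2.2.1 * (1 / ((n₁ : ℂ) - (k₁ : ℂ)) + 1 / ((n₁ : ℂ) + (k₁ : ℂ))) +
          2 * RIUW.2.2.2 * (1 / ((n₁ : ℂ) - (k₂ : ℂ)) + 1 / ((n₁ : ℂ) + (k₂ : ℂ))),
        RIUW.1 / (n₂ : ℂ) ^ 2 + Complex.I * RIUW.2.1 / (n₂ : ℂ) +
          2 * RIUW.2.2.1 * (1 / ((n₂ : ℂ) - (k₁ : ℂ)) + 1 / ((n₂ : ℂ) + (k₁ : ℂ))) +
          2 * RIUW.2.2.2 * (1 / ((n₂ : ℂ) - (k₂ : ℂ)) + 1 / ((n₂ : ℂ) + (k₂ : ℂ))),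
        RIUW.1 / (n₃ : ℂ) ^ 2 + Complex.I * RIUW.2.1 / (n₃ : ℂ) +
          2 * RIUW.2.2.1 * (1 / ((n₃ : ℂ) - (k₁ : ℂ)) + 1 / ((n₃ : ℂ) + (k₁ : ℂ))) +
          2 * RIUW.2.2.2 * (1 / ((n₃ : ℂ) - (k₂ : ℂ)) + 1 / ((n₃ : ℂ) + (k₂ : ℂ))),
        RIUW.1 / (n₄ : ℂ) ^ 2 + Complex.I * RIUW.2.1 / (n₄ : ℂ) +
          2 * RIUW.2.2.1 * (1 / ((n₄ : ℂ) - (k₁ : ℂ)) + 1 / ((n₄ : ℂ) + (k₁ : ℂ))) +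
          2 * RIUW.2.2.2 * (1 / ((n₄ : ℂ) - (k₂ : ℂ)) + 1 / ((n₄ : ℂ) + (k₂ : ℂ)))) :
        ℂ × ℂ × ℂ × ℂ)) := by
  simp only [List.pairwise_cons, List.mem_cons, List.not_mem_nil, or_false, forall_eq_or_imp,
    forall_eq] at hdist
  obtain ⟨⟨h12, h13, h14, h1k, h1l⟩, ⟨h23, h24, h2k, h2l⟩, ⟨h34, h3k, h3l⟩, ⟨h4k, h4l⟩, hkl, -⟩ :=
    hdist
  obtain ⟨p1, p2, p3, p4, pk, pl⟩ := hpos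
  set f := (fun RIUW : ℂ × ℂ × ℂ × ℂ => (_ : ℂ × ℂ × ℂ × ℂ)) with hf
  have hlin : IsLinearMap ℂ f := by
    constructor
    · intro x y
      simp only [hf, Prod.ext_iff, Prod.fst_add, Prod.snd_add]
      refine ⟨?_, ?_, ?_, ?_⟩ <;> ring
    · intro x y
      simp only [hf, Prod.ext_iff, Prod.smul_fst, Prod.smul_snd, smul_eq_mul]
      refine ⟨?_, ?_, ?_, ?_⟩ <;> ring
  have hinj : Function.Injective (hlin.mk' f) := by
    rw [injective_iff_map_eq_zero]
    rintro ⟨R, I, U, W⟩ h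
    rw [IsLinearMap.mk'_apply] at h
    simp only [hf, Prod.ext_iff, Prod.fst_zero, Prod.snd_zero] at h
    obtain ⟨e1, e2, e3, e4⟩ := h
    have e1 := aux_eq n₁ k₁ k₂ p1 h1k h1l R I U W e1
    have e2 := aux_eq n₂ k₁ k₂ p2 h2k h2l R I U W e2
    have e3 := aux_eq n₃ k₁ k₂ p3 h3k h3l R I U W e3
    have e4 := aux_eq n₄ k₁ k₂ p4 h4k h4l R I U W e4
    obtain ⟨hR, hA, hB, hC⟩ := aux_R n₁ n₂ n₃ n₄ k₁ k₂ p1 p2 p3 p4 pk pl h12 h13 h14 h23 h24 h34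
      R (Complex.I * I * (k₁ : ℂ) ^ 2 * (k₂ : ℂ) ^ 2)
      (-(Complex.I * I) * ((k₁ : ℂ) ^ 2 + (k₂ : ℂ) ^ 2) - 4 * U * (k₂ : ℂ) ^ 2
          - 4 * W * (k₁ : ℂ) ^ 2) (Complex.I * I + 4 * U + 4 * W) (by
        clear hlin hf
        clear f
        intro n hn
        rcases hn with h | h | h | h
        · rw [h]; exact e1
        · rw [h]; exact e2
        · rw [h]; exact e3
        · rw [h]; exact e4)
    have hI : I = 0 := by simpa [pk.ne', pl.ne'] using hA
    subst hI
    have hU : U = 0 := (mul_eq_zero.1 (by linear_combination (1/4) * hB + (1/4) * (k₁ : ℂ) ^ 2 * hC :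
      ((k₁ : ℂ) ^ 2 - (k₂ : ℂ) ^ 2) * U = 0)).resolve_left (aux_sq k₁ k₂ hkl)
    subst hU
    have hW : W = 0 := by simpa using hC
    simp [hR, hW]
  have hsurj := LinearMap.injective_iff_surjective.1 hinj
  clear_value f
  exact ⟨hinj, hsurj⟩
end

section
/- Let A_d be a real n×n matrix and γ > 0 such that ρᵀ·(I − A_dᵀ·A_d)·ρ ≥ γ·‖ρ‖² for all ρ ∈ ℝⁿ. Let τ ∈ (0,1], let σ ≥ 0 satisfy 2σ + σ² ≤ γ/2, and let ρ, q ∈ ℝⁿ with ‖q‖ ≤ σ·‖ρ‖. Then ‖A_d·ρ + τ·q‖² ≤ (1 − γ/2)·‖ρ‖². -/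
open Matrix RealInnerProductSpace

/-- One-step decrease of the Lyapunov function `V(ρ) = ρᵀρ` along the perturbed
iteration `ρ ↦ A_d ρ + τ q` (Appendix II). -/
theorem lyapunov_one_step_decrease
    (n : ℕ) (A_d : Matrix (Fin n) (Fin n) ℝ) (γ : ℝ) (hγ : 0 < γ)
    (hA : ∀ ρ : EuclideanSpace ℝ (Fin n),
      ⟪ρ, Matrix.toEuclideanLin (1 - A_dᵀ * A_d) ρ⟫ ≥ γ * ‖ρ‖ ^ 2)
    (τ : ℝ) (hτ : τ ∈ Set.Ioc (0:ℝ) 1)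
    (σ : ℝ) (hσ : 0 ≤ σ) (hσγ : 2 * σ + σ ^ 2 ≤ γ / 2)
    (ρ q : EuclideanSpace ℝ (Fin n)) (hq : ‖q‖ ≤ σ * ‖ρ‖) :
    ‖Matrix.toEuclideanLin A_d ρ + τ • q‖ ^ 2 ≤ (1 - γ / 2) * ‖ρ‖ ^ 2 := by
  have h1 := hA ρ
  have key : ⟪ρ, Matrix.toEuclideanLin (1 - A_dᵀ * A_d) ρ⟫
      = ‖ρ‖ ^ 2 - ‖Matrix.toEuclideanLin A_d ρ‖ ^ 2 := by
    rw [← real_inner_self_eq_norm_sq, ← real_inner_self_eq_norm_sq]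
    simp only [EuclideanSpace.inner_eq_star_dotProduct, Matrix.ofLp_toLpLin, Matrix.toLin'_apply,
      star_trivial, Matrix.sub_mulVec, Matrix.one_mulVec, sub_dotProduct]
    rw [← Matrix.mulVec_mulVec, Matrix.mulVec_transpose, ← Matrix.dotProduct_mulVec]
  rw [key] at h1
  set a := ‖Matrix.toEuclideanLin A_d ρ‖ with ha
  have ha0 : 0 ≤ a := norm_nonneg _
  have hr0 : 0 ≤ ‖ρ‖ := norm_nonneg _
  have har : a ≤ ‖ρ‖ := by
    refine (sq_le_sq₀ ha0 hr0).1 ?_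
    nlinarith [mul_nonneg hγ.le (sq_nonneg ‖ρ‖)]
  have hs : ‖τ • q‖ ≤ σ * ‖ρ‖ := by
    rw [norm_smul, Real.norm_of_nonneg hτ.1.le]
    exact (mul_le_of_le_one_left (norm_nonneg _) hτ.2).trans hq
  have ht : ‖Matrix.toEuclideanLin A_d ρ + τ • q‖ ≤ a + σ * ‖ρ‖ :=
    (norm_add_le _ _).trans (by linarith)
  have h2 : ‖Matrix.toEuclideanLin A_d ρ + τ • q‖ ^ 2 ≤ (a + σ * ‖ρ‖) ^ 2 :=
    pow_le_pow_left₀ (norm_nonneg _) ht 2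
  have h3 : a * (σ * ‖ρ‖) ≤ ‖ρ‖ * (σ * ‖ρ‖) :=
    mul_le_mul_of_nonneg_right har (mul_nonneg hσ hr0)
  have h4 := mul_le_mul_of_nonneg_right hσγ (sq_nonneg ‖ρ‖)
  nlinarith
end

section
/- Let A_d be a real n×n matrix and γ > 0 such that ρᵀ·(I − A_dᵀ·A_d)·ρ ≥ γ·‖ρ‖² for all ρ ∈ ℝⁿ. Let τ ∈ (0,1] and η > 0, and let P : ℝᵐ × ℝⁿ → ℝⁿ and Θ : ℝᵐ × ℝⁿ → ℝᵐ be functions for which there exist σ ≥ 0 with 2σ + σ² < γ/2 and m̄ ≥ 0 such that ‖P(θ,ρ)‖ ≤ σ·‖ρ‖ and ‖Θ(θ,ρ)‖ ≤ m̄·‖ρ‖ whenever ‖θ‖ + ‖ρ‖ ≤ η. Then there exists η₀ ∈ (0, η) such that any sequences (θ_k)_{k≥0} in ℝᵐ and (ρ_k)_{k≥0} in ℝⁿ satisfying θ_{k+1} = θ_k + τ·Θ(θ_k, ρ_k) and ρ_{k+1} = A_d·ρ_k + τ·P(θ_k, ρ_k) with ‖θ₀‖ + ‖ρ₀‖ ≤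 η₀ satisfy, for all k ≥ 0: ‖θ_k‖ + ‖ρ_k‖ ≤ η, ‖ρ_k‖² ≤ (1 − γ/2)^k·‖ρ₀‖² (so ρ_k → 0 exponentially fast), and the sequence (θ_k) converges. -/
open Matrix RealInnerProductSpace Filter

/-- Theorem 3 (discrete-time Malkin theorem, Appendix II): for the discretized Malkin
structure `θ_{k+1} = θ_k + τ Θ(θ_k, ρ_k)`, `ρ_{k+1} = A_d ρ_k + τ P(θ_k, ρ_k)`, there is a
ball of initial conditions on which trajectories stay in the ball of radius `η`, `ρ_k → 0`
exponentially fast, and `θ_k` converges. -/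
theorem discrete_malkin_convergence
    (n m : ℕ) (A_d : Matrix (Fin n) (Fin n) ℝ) (γ : ℝ) (hγ : 0 < γ)
    (hA : ∀ ρ : EuclideanSpace ℝ (Fin n),
      ⟪ρ, Matrix.toEuclideanLin (1 - A_dᵀ * A_d) ρ⟫ ≥ γ * ‖ρ‖ ^ 2)
    (τ : ℝ) (hτ : τ ∈ Set.Ioc (0:ℝ) 1) (η : ℝ) (hη : 0 < η)
    (P : EuclideanSpace ℝ (Fin m) → EuclideanSpace ℝ (Fin n) → EuclideanSpace ℝ (Fin n))
    (Θ : EuclideanSpace ℝ (Fin m) → EuclideanSpace ℝ (Fin n) → EuclideanSpace ℝ (Fin m))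
    (σ : ℝ) (hσ : 0 ≤ σ) (hσγ : 2 * σ + σ ^ 2 < γ / 2)
    (mBar : ℝ) (hmBar : 0 ≤ mBar)
    (hP : ∀ θ ρ, ‖θ‖ + ‖ρ‖ ≤ η → ‖P θ ρ‖ ≤ σ * ‖ρ‖)
    (hΘ : ∀ θ ρ, ‖θ‖ + ‖ρ‖ ≤ η → ‖Θ θ ρ‖ ≤ mBar * ‖ρ‖) :
    ∃ η₀ : ℝ, 0 < η₀ ∧ η₀ < η ∧
      ∀ (θ : ℕ → EuclideanSpace ℝ (Fin m)) (ρ : ℕ → EuclideanSpace ℝ (Fin n)),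
        (∀ k, θ (k + 1) = θ k + τ • Θ (θ k) (ρ k)) →
        (∀ k, ρ (k + 1) = Matrix.toEuclideanLin A_d (ρ k) + τ • P (θ k) (ρ k)) →
        ‖θ 0‖ + ‖ρ 0‖ ≤ η₀ →
        (∀ k, ‖θ k‖ + ‖ρ k‖ ≤ η) ∧
        (∀ k, ‖ρ k‖ ^ 2 ≤ (1 - γ / 2) ^ k * ‖ρ 0‖ ^ 2) ∧
        ∃ θlim : EuclideanSpace ℝ (Fin m), Tendsto θ atTop (nhds θlim) := by
  have hA2 : ∀ x : EuclideanSpace ℝ (Fin n),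
      ‖Matrix.toEuclideanLin A_d x‖ ^ 2 ≤ (1 - γ) * ‖x‖ ^ 2 := by
    intro x
    have h := hA x
    have e : Matrix.toEuclideanLin (1 - A_dᵀ * A_d) x
        = x - Matrix.toEuclideanLin A_dᵀ (Matrix.toEuclideanLin A_d x) := by
      ext i
      simp [Matrix.toLpLin_apply, Matrix.sub_mulVec, Matrix.mulVec_mulVec]
    have e2 : ⟪x, Matrix.toEuclideanLin A_dᵀ (Matrix.toEuclideanLin A_d x)⟫
        = ‖Matrix.toEuclideanLin A_d x‖ ^ 2 := by
      rw [← Matrix.conjTranspose_eq_transpose_of_trivial,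
        Matrix.toEuclideanLin_conjTranspose_eq_adjoint, LinearMap.adjoint_inner_right,
        real_inner_self_eq_norm_sq]
    rw [e, inner_sub_right, e2, real_inner_self_eq_norm_sq] at h
    linarith
  obtain ⟨hτ0, hτ1⟩ := hτ
  have key : ∀ θ ρ, ‖θ‖ + ‖ρ‖ ≤ η →
      ‖Matrix.toEuclideanLin A_d ρ + τ • P θ ρ‖ ^ 2 ≤ (1 - γ / 2) * ‖ρ‖ ^ 2 := by
    intro θ ρ h
    have h1 := hA2 ρ
    have h2 := hP θ ρ h
    have h0 := norm_nonneg ρ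
    have ha := norm_nonneg (Matrix.toEuclideanLin A_d ρ)
    have h3 : ‖Matrix.toEuclideanLin A_d ρ‖ ≤ ‖ρ‖ := by
      refine (pow_le_pow_iff_left₀ (norm_nonneg _) h0 two_ne_zero).1 ?_
      nlinarith [mul_nonneg hγ.le (sq_nonneg ‖ρ‖)]
    have h4 : ‖Matrix.toEuclideanLin A_d ρ + τ • P θ ρ‖
        ≤ ‖Matrix.toEuclideanLin A_d ρ‖ + σ * ‖ρ‖ := by
      refine (norm_add_le _ _).trans ?_
      rw [norm_smul, Real.norm_of_nonneg hτ0.le]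
      nlinarith [norm_nonneg (P θ ρ)]
    have h5 := pow_le_pow_left₀ (norm_nonneg _) h4 2
    have h6 := mul_le_mul_of_nonneg_left h3 (mul_nonneg hσ h0)
    have h7 := mul_le_mul_of_nonneg_right hσγ.le (sq_nonneg ‖ρ‖)
    nlinarith
  obtain ⟨q, hq0, hq1, hq⟩ : ∃ q : ℝ, 0 ≤ q ∧ q < 1 ∧ 1 - γ / 2 ≤ q ^ 2 := by
    refine ⟨√(max (1 - γ / 2) 0), Real.sqrt_nonneg _, ?_, ?_⟩
    · rw [Real.sqrt_lt' one_pos]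
      simp [hγ]
    · rw [Real.sq_sqrt (le_max_right _ _)]
      exact le_max_left _ _
  have key2 : ∀ θ ρ, ‖θ‖ + ‖ρ‖ ≤ η →
      ‖Matrix.toEuclideanLin A_d ρ + τ • P θ ρ‖ ≤ q * ‖ρ‖ := by
    intro θ ρ h
    refine (pow_le_pow_iff_left₀ (norm_nonneg _) (by positivity) two_ne_zero).1 ?_
    rw [mul_pow]
    exact (key θ ρ h).trans (by gcongr)
  have hq' : 0 < 1 - q := by linarith
  obtain ⟨C, hC1, hC⟩ : ∃ C : ℝ, 1 ≤ C ∧ mBar + C * q ≤ C := by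
    refine ⟨1 + mBar / (1 - q), ?_, ?_⟩
    · have : 0 ≤ mBar / (1 - q) := by positivity
      linarith
    · have : mBar / (1 - q) * (1 - q) = mBar := by field_simp
      nlinarith
  have hC0 : 0 < C := by linarith
  refine ⟨η / (2 * C), by positivity, ?_, ?_⟩
  · rw [div_lt_iff₀ (by positivity)]
    nlinarith
  intro θ ρ hθ hρ h0
  have hθs : ∀ k, ‖θ k‖ + ‖ρ k‖ ≤ η → ‖τ • Θ (θ k) (ρ k)‖ ≤ mBar * ‖ρ k‖ := by
    intro k hk
    have := hΘ _ _ hk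
    rw [norm_smul, Real.norm_of_nonneg hτ0.le]
    nlinarith [norm_nonneg (Θ (θ k) (ρ k))]
  have hV : ∀ k, ‖θ k‖ + C * ‖ρ k‖ ≤ η := by
    intro k
    induction k with
    | zero =>
      rw [le_div_iff₀ (by positivity)] at h0
      nlinarith [norm_nonneg (θ 0), norm_nonneg (ρ 0),
        mul_nonneg (sub_nonneg.2 hC1) (norm_nonneg (θ 0))]
    | succ k ih =>
      have hk : ‖θ k‖ + ‖ρ k‖ ≤ η := by nlinarith [norm_nonneg (ρ k)]
      have a := key2 _ _ hk
      rw [← hρ] at a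
      have b : ‖θ (k+1)‖ ≤ ‖θ k‖ + mBar * ‖ρ k‖ := by
        rw [hθ]
        exact (norm_add_le _ _).trans (by linarith [hθs k hk])
      have c := mul_le_mul_of_nonneg_left a hC0.le
      have d := mul_le_mul_of_nonneg_right hC (norm_nonneg (ρ k))
      linarith
  have hB : ∀ k, ‖θ k‖ + ‖ρ k‖ ≤ η := by
    intro k
    nlinarith [norm_nonneg (ρ k), hV k]
  refine ⟨hB, ?_, ?_⟩
  · by_cases hg : γ ≤ 1
    · intro k
      induction k with
      | zero => simp
      | succ k ih =>
        have a := key _ _ (hB k)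
        rw [← hρ] at a
        have c := mul_le_mul_of_nonneg_left ih (by linarith : 0 ≤ 1 - γ / 2)
        rw [pow_succ' (1 - γ / 2) k, mul_assoc]
        linarith
    · have hz : ∀ x : EuclideanSpace ℝ (Fin n), ‖x‖ ^ 2 = 0 := by
        intro x
        have := hA2 x
        nlinarith [sq_nonneg ‖x‖, sq_nonneg ‖Matrix.toEuclideanLin A_d x‖]
      intro k
      rw [hz, hz, mul_zero]
  · have hr : ∀ k, ‖ρ k‖ ≤ q ^ k * ‖ρ 0‖ := by
      intro k
      induction k with
      | zero => simp
      | succ k ih =>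
        have a := key2 _ _ (hB k)
        rw [← hρ] at a
        have c := mul_le_mul_of_nonneg_left ih hq0
        rw [pow_succ' q k, mul_assoc]
        linarith
    apply cauchySeq_tendsto_of_complete
    apply cauchySeq_of_le_geometric q (mBar * ‖ρ 0‖) hq1
    intro k
    rw [hθ, dist_self_add_right]
    have := mul_le_mul_of_nonneg_left (hr k) hmBar
    linarith [hθs k (hB k)]
end

section
/- Let d, d' be positive reals and v_x, v_y, v_x', v_y' reals, and for each parameter triple define z²(t) = (d + v_x·t)² + (v_y·t)². If (d + v_x·t)² + (v_y·t)² = (d' + v_x'·t)² + (v_y'·t)² for all real t, then d = d', v_x = v_x', and v_x² + v_y² = v_x'² + v_y'². Moreover, the converse failure of full identifiability holds: the triples (d, v_x, v_y) and (d, v_x, −v_y) always yield identical functions z²(t), so the sign of v_y cannot be determined. -/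
/-- Remark 1: with pure linear motions, the squared-distance function
`z²(t) = (d + v_x t)² + (v_y t)²` determines the initial distance `d`, the component
`v_x` and the speed `v_x² + v_y²`, but not the sign of `v_y` (direction). -/
theorem linear_motion_partial_identifiability
    (d d' : ℝ) (hd : 0 < d) (hd' : 0 < d')
    (v_x v_y v_x' v_y' : ℝ)
    (h : ∀ t : ℝ, (d + v_x * t) ^ 2 + (v_y * t) ^ 2 = (d' + v_x' * t) ^ 2 + (v_y' * t) ^ 2) :
    (d = d' ∧ v_x = v_x' ∧ v_x ^ 2 + v_y ^ 2 = v_x' ^ 2 + v_y' ^ 2) ∧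
    (∀ t : ℝ, (d + v_x * t) ^ 2 + (v_y * t) ^ 2 = (d + v_x * t) ^ 2 + ((-v_y) * t) ^ 2) := by
  have h0 := h 0
  have h1 := h 1
  have h2 := h (-1)
  have e : d = d' := by nlinarith
  subst e
  have e2 : v_x = v_x' := by
    have : d * v_x = d * v_x' := by linarith
    exact mul_left_cancel₀ hd.ne' this
  subst e2
  refine ⟨⟨rfl, rfl, by linarith⟩, fun t => by ring⟩
end
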